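/- arXiv:1305.7413 — 3 statements merged into one kernel-verified Lean document; each statement's English description precedes it below -/
import Mathlib

section
/- Let 𝒜 be a Dyck automaton over a pushdown alphabet A and let X be the sofic-Dyck shift presented by 𝒜. Then X is exactly the set of bi-infinite sequences x ∈ A^ℤ such that every finite factor of x is the label of some finite admissible path of 𝒜. -/
namespace SD

/-- The three kinds of letters of a pushdown alphabet. -/
inductive LetterKind : Type
  | call
  | ret
  | intern
  deriving DecidableEq

/-- A pushdown alphabet structure on `A`: a partition of the letters into
call letters, return letters and internal letters. -/
structure PushdownAlphabet (A : Type*) where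
  kind : A → LetterKind

/-- Number of call letters of a word. -/
def callCount {A : Type*} (P : PushdownAlphabet A) (u : List A) : ℕ :=
  u.countP (fun a => decide (P.kind a = LetterKind.call))

/-- Number of return letters of a word. -/
def retCount {A : Type*} (P : PushdownAlphabet A) (u : List A) : ℕ :=
  u.countP (fun a => decide (P.kind a = LetterKind.ret))

/-- A word is matched-return if every prefix has at least as many call letters
as return letters. -/
def MatchedReturn {A : Type*} (P : PushdownAlphabet A) (u : List A) : Prop :=
  ∀ v w : List A, u = v ++ w → retCount P v ≤ callCount P v

/-- A word is matched-call if every suffix has at least as many return letters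
as call letters. -/
def MatchedCall {A : Type*} (P : PushdownAlphabet A) (u : List A) : Prop :=
  ∀ v w : List A, u = v ++ w → callCount P w ≤ retCount P w

/-- A Dyck word is a word which is both matched-return and matched-call. -/
def IsDyck {A : Type*} (P : PushdownAlphabet A) (u : List A) : Prop :=
  MatchedReturn P u ∧ MatchedCall P u

/-- The factor of length `n` of a bi-infinite sequence starting at position `i`. -/
def factorAt {A : Type*} (x : ℤ → A) (i : ℤ) (n : ℕ) : List A :=
  (List.range n).map (fun k => x (i + (k : ℤ)))

/-- `w` is a (finite) factor of the bi-infinite sequence `x`. -/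
def IsFactorOf {A : Type*} (w : List A) (x : ℤ → A) : Prop :=
  ∃ i : ℤ, w = factorAt x i w.length

/-- A Dyck automaton over alphabet `A` with states `Q`: a labeled graph together
with a set of matched pairs of edges. -/
structure DyckAutomaton (A : Type*) (Q : Type*) where
  edges : Set (Q × A × Q)
  matched : Set ((Q × A × Q) × (Q × A × Q))

/-- Well-formedness of a Dyck automaton: matched pairs consist of edges of the
automaton, a call edge followed by a return edge. -/
def DyckAutomaton.WellFormed {A Q : Type*} (P : PushdownAlphabet A)
    (𝒜 : DyckAutomaton A Q) : Prop :=
  ∀ e f : Q × A × Q, (e, f) ∈ 𝒜.matched →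
    e ∈ 𝒜.edges ∧ f ∈ 𝒜.edges ∧
    P.kind e.2.1 = LetterKind.call ∧ P.kind f.2.1 = LetterKind.ret

/-- The label of a finite path. -/
def pathLabel {A Q : Type*} (π : List (Q × A × Q)) : List A :=
  π.map (fun e => e.2.1)

/-- A finite path of the underlying graph: a sequence of consecutive edges. -/
def IsPath {A Q : Type*} (𝒜 : DyckAutomaton A Q) (π : List (Q × A × Q)) : Prop :=
  (∀ e ∈ π, e ∈ 𝒜.edges) ∧ π.Chain' (fun e f => e.2.2 = f.1)

/-- A finite path is admissible if for any factor `e · π₁ · f` of it with `e` a call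
edge, `f` a return edge and the label of `π₁` a Dyck word, `(e,f)` is a matched pair. -/
def IsAdmissible {A Q : Type*} (P : PushdownAlphabet A) (𝒜 : DyckAutomaton A Q)
    (π : List (Q × A × Q)) : Prop :=
  IsPath 𝒜 π ∧
  ∀ (π₀ : List (Q × A × Q)) (e : Q × A × Q) (π₁ : List (Q × A × Q)) (f : Q × A × Q)
    (π₂ : List (Q × A × Q)), π = π₀ ++ e :: π₁ ++ f :: π₂ →
    P.kind e.2.1 = LetterKind.call → P.kind f.2.1 = LetterKind.ret →
    IsDyck P (pathLabel π₁) → (e, f) ∈ 𝒜.matched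

/-- The finite factor of a bi-infinite path starting at index `i`, of length `n`. -/
def pathSeg {A Q : Type*} (π : ℤ → Q × A × Q) (i : ℤ) (n : ℕ) : List (Q × A × Q) :=
  (List.range n).map (fun k => π (i + (k : ℤ)))

/-- A bi-infinite path is admissible if it is a bi-infinite path of the graph all of
whose finite factors are admissible. -/
def BiAdmissible {A Q : Type*} (P : PushdownAlphabet A) (𝒜 : DyckAutomaton A Q)
    (π : ℤ → Q × A × Q) : Prop :=
  (∀ i : ℤ, π i ∈ 𝒜.edges) ∧ (∀ i : ℤ, (π i).2.2 = (π (i + 1)).1) ∧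
  ∀ (i : ℤ) (n : ℕ), IsAdmissible P 𝒜 (pathSeg π i n)

/-- The sofic-Dyck shift presented by a Dyck automaton: the set of labels of
bi-infinite admissible paths. -/
def presents {A Q : Type*} (P : PushdownAlphabet A) (𝒜 : DyckAutomaton A Q) :
    Set (ℤ → A) :=
  { x | ∃ π : ℤ → Q × A × Q, BiAdmissible P 𝒜 π ∧ ∀ i : ℤ, (π i).2.1 = x i }

/-- A sofic-Dyck shift over `A`: a set presented by some (finite, well-formed)
Dyck automaton. -/
def IsSoficDyck {A : Type*} (P : PushdownAlphabet A) (X : Set (ℤ → A)) : Prop :=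
  ∃ (N : ℕ) (𝒜 : DyckAutomaton A (Fin N)), 𝒜.WellFormed P ∧ X = presents P 𝒜

/-- A finite path goes from `p` to `q` (an empty path goes from `p` to `p`). -/
def GoesFromTo {A Q : Type*} (π : List (Q × A × Q)) (p q : Q) : Prop :=
  (∀ e ∈ π.head?, e.1 = p) ∧ (∀ e ∈ π.getLast?, e.2.2 = q) ∧ (π = [] → p = q)

/-- A finite path starts at state `p`. -/
def StartsAt {A Q : Type*} (π : List (Q × A × Q)) (p : Q) : Prop :=
  ∀ e ∈ π.head?, e.1 = p

theorem IsAdmissible.of_infix {A Q : Type*} {P : PushdownAlphabet A} {𝒜 : DyckAutomaton A Q}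
    {π ρ : List (Q × A × Q)} (h : IsAdmissible P 𝒜 ρ) (hπ : π <:+: ρ) : IsAdmissible P 𝒜 π := by
  refine ⟨⟨fun e he => h.1.1 e (hπ.subset he), h.1.2.infix hπ⟩, ?_⟩
  intro π₀ e π₁ f π₂ hfac he hf hD
  obtain ⟨u, v, rfl⟩ := hπ
  exact h.2 (u ++ π₀) e π₁ f (π₂ ++ v) (by simp [hfac]) he hf hD

theorem getElem?_factorAt {A : Type*} (x : ℤ → A) (i : ℤ) (n k : ℕ) :
    (factorAt x i n)[k]? = if k < n then some (x (i + k)) else none := by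
  have hmap : factorAt x i n = (List.range n).map (fun j : ℕ => x (i + j)) := by
    simp [factorAt, ← List.map_eq_flatMap]
  rw [hmap]
  split_ifs with h
  · simp [h]
  · simpa using h

theorem getElem?_pathSeg {A Q : Type*} (π : ℤ → Q × A × Q) (i : ℤ) (n k : ℕ) :
    (pathSeg π i n)[k]? = if k < n then some (π (i + k)) else none :=
  getElem?_factorAt π i n k

theorem length_factorAt {A : Type*} (x : ℤ → A) (i : ℤ) (n : ℕ) :
    (factorAt x i n).length = n := by
  simp [factorAt]

/-- A sequence in a finite type is constant along any ultrafilter. -/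
theorem exists_eventually_eq_of_finite {ι α : Type*} [Finite α] (U : Ultrafilter ι)
    (f : ι → α) : ∃ c, ∀ᶠ n in (U : Filter ι), f n = c := by
  obtain ⟨c, hc⟩ := (U.map f).eq_pure_of_finite
  refine ⟨c, ?_⟩
  have : {c} ∈ U.map f := by rw [hc]; exact Set.mem_singleton c
  exact this

theorem pathLabel_pathSeg {A Q : Type*} (π : ℤ → Q × A × Q) (i : ℤ) (n : ℕ) :
    pathLabel (pathSeg π i n) = factorAt (fun j => (π j).2.1) i n := by
  simp [pathLabel, pathSeg, factorAt]

theorem BiAdmissible.of_pathSeg {A Q : Type*} {P : PushdownAlphabet A} {𝒜 : DyckAutomaton A Q}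
    {π : ℤ → Q × A × Q} (h : ∀ (i : ℤ) (n : ℕ), IsAdmissible P 𝒜 (pathSeg π i n)) :
    BiAdmissible P 𝒜 π := by
  refine ⟨fun i => (h i 1).1.1 _ (by simp [pathSeg]), fun i => ?_, h⟩
  have h2 : List.IsChain (fun e f => e.2.2 = f.1) (pathSeg π i 2) := (h i 2).1.2
  simpa [pathSeg, List.range_succ] using h2

/-- Compactness: if central factors of `x` of every radius label admissible paths, then `x`
labels a bi-infinite admissible path. -/
theorem mem_presents_of_central_factors {A Q : Type*} [Finite A] [Finite Q]
    {P : PushdownAlphabet A} {𝒜 : DyckAutomaton A Q} {x : ℤ → A}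
    (h : ∀ n : ℕ, ∃ π : List (Q × A × Q), IsAdmissible P 𝒜 π ∧
      pathLabel π = factorAt x (-n) (2 * n + 1)) :
    x ∈ presents P 𝒜 := by
  choose ρ hρ hlab using h
  have hmap : ∀ n k : ℕ, (ρ n)[k]?.map (fun e => e.2.1) =
      if k < 2 * n + 1 then some (x (-n + k)) else none := by
    intro n k
    rw [← getElem?_factorAt, ← hlab, pathLabel, List.getElem?_map]
  let U : Ultrafilter ℕ := Filter.hyperfilter ℕ
  have hlarge : ∀ m : ℕ, ∀ᶠ n in (U : Filter ℕ), m ≤ n := fun m =>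
    Nat.hyperfilter_le_atTop (Filter.eventually_ge_atTop m)
  have key : ∀ i : ℤ, ∃ e : Q × A × Q, e.2.1 = x i ∧
      ∀ᶠ n in (U : Filter ℕ), (ρ n)[(i + n).toNat]? = some e := by
    intro i
    obtain ⟨c, hc⟩ := exists_eventually_eq_of_finite U (fun n : ℕ => (ρ n)[(i + n).toNat]?)
    obtain ⟨n, hn, hin⟩ := (hc.and (hlarge i.natAbs)).exists
    have hx := hmap n (i + n).toNat
    rw [hn, if_pos (by omega), show (-n + ((i + n).toNat : ℤ)) = i by omega] at hx
    obtain ⟨e, rfl, he⟩ := Option.map_eq_some_iff.mp hx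
    exact ⟨e, he, hc⟩
  choose π hπx hπ using key
  refine ⟨π, BiAdmissible.of_pathSeg fun i n => ?_, hπx⟩
  have hall : ∀ᶠ m in (U : Filter ℕ), ∀ k ∈ Finset.range n,
      (ρ m)[(i + k + m).toNat]? = some (π (i + k)) :=
    (Filter.eventually_all_finset _).mpr fun k _ => hπ (i + k)
  obtain ⟨m, hm, him⟩ := (hall.and (hlarge i.natAbs)).exists
  refine (hρ m).of_infix ?_
  have heq : pathSeg π i n = ((ρ m).drop (i + m).toNat).take n := by
    refine List.ext_getElem? fun k => ?_
    rw [getElem?_pathSeg, List.getElem?_take]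
    split_ifs with hk
    · rw [List.getElem?_drop, ← hm k (Finset.mem_range.mpr hk)]
      congr 1
      omega
    · rfl
  rw [heq]
  exact (List.take_prefix _ _).isInfix.trans (List.drop_suffix _ _).isInfix

end SD

open SD

/-- The sofic-Dyck shift presented by a Dyck automaton is exactly the set of
bi-infinite sequences all of whose finite factors label finite admissible paths. -/
theorem statement_0 {A : Type*} [Fintype A] (P : PushdownAlphabet A) {N : ℕ}
    (𝒜 : DyckAutomaton A (Fin N)) (h𝒜 : 𝒜.WellFormed P) :
    presents P 𝒜 =
      { x : ℤ → A | ∀ w : List A, IsFactorOf w x →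
          ∃ π : List (Fin N × A × Fin N), IsAdmissible P 𝒜 π ∧ pathLabel π = w } := by
  ext x
  constructor
  · rintro ⟨π, hπ, hx⟩ w ⟨i, hw⟩
    refine ⟨pathSeg π i w.length, hπ.2.2 i _, ?_⟩
    rw [pathLabel_pathSeg, funext hx, ← hw]
  · intro h
    exact mem_presents_of_central_factors fun n =>
      h _ ⟨-n, by rw [length_factorAt]⟩
end

section
/- Every sofic-Dyck shift over a pushdown alphabet A is a subshift of A^ℤ, i.e. it is shift-invariant and closed in the product of the discrete topology. -/
namespace SD

/-- The segments of a shifted path are shifted segments of the path. -/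
theorem pathSeg_add_right {A Q : Type*} (π : ℤ → Q × A × Q) (c i : ℤ) (n : ℕ) :
    pathSeg (fun j => π (j + c)) i n = pathSeg π (i + c) n := by
  simp only [pathSeg, add_right_comm]

theorem BiAdmissible.comp_add_right {A Q : Type*} {P : PushdownAlphabet A}
    {𝒜 : DyckAutomaton A Q} {π : ℤ → Q × A × Q} (h : BiAdmissible P 𝒜 π) (c : ℤ) :
    BiAdmissible P 𝒜 (fun j => π (j + c)) := by
  refine ⟨fun i => h.1 _, fun i => ?_, fun i n => ?_⟩
  · simpa only [add_right_comm] using h.2.1 (i + c)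
  · rw [pathSeg_add_right]
    exact h.2.2 _ _

theorem comp_add_right_mem_presents {A Q : Type*} {P : PushdownAlphabet A}
    {𝒜 : DyckAutomaton A Q} {x : ℤ → A} (hx : x ∈ presents P 𝒜) (c : ℤ) :
    (fun i => x (i + c)) ∈ presents P 𝒜 := by
  obtain ⟨π, hπ, hl⟩ := hx
  exact ⟨_, hπ.comp_add_right c, fun i => hl (i + c)⟩

theorem shift_image_presents {A Q : Type*} (P : PushdownAlphabet A) (𝒜 : DyckAutomaton A Q) :
    (fun x : ℤ → A => fun i : ℤ => x (i + 1)) '' presents P 𝒜 = presents P 𝒜 := by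
  ext y
  constructor
  · rintro ⟨x, hx, rfl⟩
    exact comp_add_right_mem_presents hx 1
  · intro hy
    refine ⟨fun i => y (i + -1), comp_add_right_mem_presents hy (-1), ?_⟩
    funext i
    simp

/-- A condition on a finite segment of a sequence over a discrete space is closed. -/
theorem isClosed_setOf_pathSeg {A Q : Type*} [TopologicalSpace A] [DiscreteTopology A]
    [TopologicalSpace Q] [DiscreteTopology Q] (C : List (Q × A × Q) → Prop) (i : ℤ) (n : ℕ) :
    IsClosed {π : ℤ → Q × A × Q | C (pathSeg π i n)} := by
  have hcont : Continuous fun (π : ℤ → Q × A × Q) (k : Fin n) => π (i + (k : ℕ)) := by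
    fun_prop
  have heq : {π : ℤ → Q × A × Q | C (pathSeg π i n)} =
      (fun (π : ℤ → Q × A × Q) (k : Fin n) => π (i + (k : ℕ))) ⁻¹'
        {f | C (List.ofFn f)} := by
    ext π
    have : pathSeg π i n = List.ofFn fun k : Fin n => π (i + (k : ℕ)) := by
      apply List.ext_getElem <;> simp [pathSeg, ← List.map_eq_flatMap]
    simp [this]
  rw [heq]
  exact (isClosed_discrete _).preimage hcont

theorem isClosed_setOf_biAdmissible {A Q : Type*} [TopologicalSpace A] [DiscreteTopology A]
    [TopologicalSpace Q] [DiscreteTopology Q] (P : PushdownAlphabet A) (𝒜 : DyckAutomaton A Q) :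
    IsClosed {π | BiAdmissible P 𝒜 π} := by
  simp only [BiAdmissible, Set.ofPred_and, Set.ofPred_forall]
  refine (isClosed_iInter fun i => ?_).inter ((isClosed_iInter fun i => ?_).inter
    (isClosed_iInter fun i => isClosed_iInter fun n => isClosed_setOf_pathSeg _ i n))
  · exact (isClosed_discrete 𝒜.edges).preimage (continuous_apply i)
  · exact isClosed_eq (by fun_prop) (by fun_prop)

theorem isClosed_presents {A Q : Type*} [Finite A] [TopologicalSpace A] [DiscreteTopology A]
    [Finite Q] (P : PushdownAlphabet A) (𝒜 : DyckAutomaton A Q) :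
    IsClosed (presents P 𝒜) := by
  let _ : TopologicalSpace Q := ⊥
  have : DiscreteTopology Q := ⟨rfl⟩
  have himage : presents P 𝒜 =
      (fun (π : ℤ → Q × A × Q) (i : ℤ) => (π i).2.1) '' {π | BiAdmissible P 𝒜 π} := by
    ext x
    simp [presents, funext_iff]
  rw [himage]
  exact ((isClosed_setOf_biAdmissible P 𝒜).isCompact.image (by fun_prop)).isClosed

end SD

open SD

/-- A sofic-Dyck shift is a subshift: it is shift-invariant and closed in the product
of the discrete topology. -/
theorem statement_1 {A : Type*} [Fintype A] [TopologicalSpace A] [DiscreteTopology A]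
    (P : PushdownAlphabet A) (X : Set (ℤ → A)) (hX : IsSoficDyck P X) :
    (fun x : ℤ → A => fun i : ℤ => x (i + 1)) '' X = X ∧ IsClosed X := by
  obtain ⟨N, 𝒜, -, rfl⟩ := hX
  exact ⟨shift_image_presents P 𝒜, isClosed_presents P 𝒜⟩
end

section
/- Let X be a sofic-Dyck shift over a pushdown alphabet A and let Φ : X → B^ℤ be a proper block map into a pushdown alphabet B. Then the image Φ(X) is a sofic-Dyck shift over B. -/
namespace SD

/-- `Φ` is an `(m,n)`-block map on `X` for some `m, n`: there is a block function `φ`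
with `Φ(x)_i = φ(x_{i-m} ⋯ x_{i+n})` for all `x ∈ X` and `i ∈ ℤ`. -/
def IsBlockMapOn {A B : Type*} (X : Set (ℤ → A)) (Φ : (ℤ → A) → ℤ → B) : Prop :=
  ∃ (m n : ℕ) (φ : List A → B),
    ∀ x ∈ X, ∀ i : ℤ, Φ x i = φ (factorAt x (i - (m : ℤ)) (m + n + 1))

/-- A map is proper on `X` if it sends call (resp. return, internal) letters to
call (resp. return, internal) letters. -/
def IsProperOn {A B : Type*} (P : PushdownAlphabet A) (PB : PushdownAlphabet B)
    (X : Set (ℤ → A)) (Φ : (ℤ → A) → ℤ → B) : Prop :=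
  ∀ x ∈ X, ∀ i : ℤ, PB.kind (Φ x i) = P.kind (x i)

end SD

open SD

namespace SD

theorem countP_kind_eq {A B : Type*} {P : PushdownAlphabet A} {PB : PushdownAlphabet B}
    {u : List A} {v : List B} (h : u.map P.kind = v.map PB.kind) (κ : LetterKind) :
    u.countP (fun a => decide (P.kind a = κ)) = v.countP (fun b => decide (PB.kind b = κ)) := by
  have := congrArg (List.countP (fun k => decide (k = κ))) h
  simpa only [List.countP_map, Function.comp_def] using this

/-- Whether a word is Dyck depends only on the kinds of its letters. -/
theorem IsDyck.of_map_kind_eq {A B : Type*} {P : PushdownAlphabet A} {PB : PushdownAlphabet B}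
    {u : List A} {v : List B} (h : u.map P.kind = v.map PB.kind) (hu : IsDyck P u) :
    IsDyck PB v := by
  have key : ∀ v₁ v₂ : List B, v = v₁ ++ v₂ → ∃ u₁ u₂ : List A, u = u₁ ++ u₂ ∧
      u₁.map P.kind = v₁.map PB.kind ∧ u₂.map P.kind = v₂.map PB.kind := by
    rintro v₁ v₂ rfl
    rw [List.map_append] at h
    exact List.map_eq_append_iff.1 h
  constructor
  · intro v₁ v₂ hv
    obtain ⟨u₁, u₂, hu', h₁, -⟩ := key v₁ v₂ hv
    have := hu.1 u₁ u₂ hu'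
    simpa only [retCount, callCount, countP_kind_eq h₁] using this
  · intro v₁ v₂ hv
    obtain ⟨u₁, u₂, hu', -, h₂⟩ := key v₁ v₂ hv
    have := hu.2 u₁ u₂ hu'
    simpa only [retCount, callCount, countP_kind_eq h₂] using this

theorem factorAt_eq_map {A : Type*} (x : ℤ → A) (i : ℤ) (n : ℕ) :
    factorAt x i n = (List.range n).map fun k : ℕ => x (i + k) := by
  simp [factorAt, ← List.map_eq_flatMap, Function.comp_def]

theorem pathSeg_eq_map {A Q : Type*} (π : ℤ → Q × A × Q) (i : ℤ) (n : ℕ) :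
    pathSeg π i n = (List.range n).map fun k : ℕ => π (i + k) := by
  simp [pathSeg, ← List.map_eq_flatMap, Function.comp_def]

theorem length_pathSeg {A Q : Type*} (π : ℤ → Q × A × Q) (i : ℤ) (n : ℕ) :
    (pathSeg π i n).length = n := by
  simp [pathSeg_eq_map]

theorem pathSeg_eq_append {A Q : Type*} {π : ℤ → Q × A × Q} {i : ℤ} {n : ℕ}
    {l₁ l₂ : List (Q × A × Q)} (h : pathSeg π i n = l₁ ++ l₂) :
    l₁ = pathSeg π i l₁.length ∧ l₂ = pathSeg π (i + l₁.length) l₂.length := by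
  have hn : n = l₁.length + l₂.length := by
    simpa [length_pathSeg] using congrArg List.length h
  subst hn
  have h' : pathSeg π i (l₁.length + l₂.length) =
      pathSeg π i l₁.length ++ pathSeg π (i + l₁.length) l₂.length := by
    simp [pathSeg_eq_map, List.range_add, Function.comp_def, add_assoc]
  rw [h'] at h
  obtain ⟨h₁, h₂⟩ := List.append_inj h (length_pathSeg _ _ _)
  exact ⟨h₁.symm, h₂.symm⟩

theorem pathSeg_succ {A Q : Type*} (π : ℤ → Q × A × Q) (i : ℤ) (n : ℕ) :
    pathSeg π i (n + 1) = π i :: pathSeg π (i + 1) n := by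
  simp [pathSeg_eq_map, List.range_succ_eq_map, Function.comp_def, add_assoc, add_comm (1 : ℤ)]

theorem map_kind_pathLabel_pathSeg_congr {A B Q S : Type*} {P : PushdownAlphabet A}
    {PB : PushdownAlphabet B} {π : ℤ → Q × A × Q} {ρ : ℤ → S × B × S}
    (h : ∀ i, P.kind (π i).2.1 = PB.kind (ρ i).2.1) (i : ℤ) (n : ℕ) :
    (pathLabel (pathSeg π i n)).map P.kind = (pathLabel (pathSeg ρ i n)).map PB.kind := by
  simp [pathLabel, pathSeg_eq_map, Function.comp_def, h]

/-- Admissibility of a bi-infinite path, expressed through positions instead of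
factorizations. -/
theorem biAdmissible_iff {A Q : Type*} (P : PushdownAlphabet A) (𝒜 : DyckAutomaton A Q)
    (π : ℤ → Q × A × Q) :
    BiAdmissible P 𝒜 π ↔
      (∀ i, π i ∈ 𝒜.edges) ∧ (∀ i, (π i).2.2 = (π (i + 1)).1) ∧
      ∀ (i : ℤ) (n : ℕ), P.kind (π i).2.1 = LetterKind.call →
        P.kind (π (i + 1 + n)).2.1 = LetterKind.ret →
        IsDyck P (pathLabel (pathSeg π (i + 1) n)) →
        (π i, π (i + 1 + n)) ∈ 𝒜.matched := by
  refine and_congr_right fun hedge => and_congr_right fun hchain => ⟨?_, ?_⟩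
  · intro h i n hcall hret hdyck
    refine (h i (n + 1 + 1)).2 [] (π i) (pathSeg π (i + 1) n) (π (i + 1 + n)) [] ?_
      hcall hret hdyck
    rw [pathSeg_succ]
    simp [pathSeg_eq_map, List.range_succ]
  · intro h i n
    refine ⟨⟨?_, ?_⟩, ?_⟩
    · intro e he
      obtain ⟨k, -, rfl⟩ := List.mem_map.1 (pathSeg_eq_map π i n ▸ he)
      exact hedge _
    · refine List.isChain_iff_getElem.2 fun k hk => ?_
      simp only [pathSeg_eq_map, List.getElem_map, List.getElem_range, hchain]
      push_cast
      rw [add_assoc]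
    · intro π₀ e π₁ f π₂ hfac hcall hret hdyck
      rw [List.append_assoc] at hfac
      have h₁ := (pathSeg_eq_append hfac).2
      rw [List.cons_append, List.length_cons, pathSeg_succ, List.cons.injEq] at h₁
      obtain ⟨rfl, h₂⟩ := h₁
      obtain ⟨h₃, h₄⟩ := pathSeg_eq_append h₂.symm
      rw [List.length_cons, pathSeg_succ, List.cons.injEq] at h₄
      obtain ⟨rfl, -⟩ := h₄
      rw [h₃] at hdyck
      exact h _ _ hcall hret hdyck

/-- The edges of the sliding-window automaton: the window encoded by the target is a shift of
the one encoded by the source, and the label is the image under `φ` of the label of the source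
window, of the same kind as the label of its central edge. -/
def windowEdges {A B Q S : Type*} (P : PushdownAlphabet A) (PB : PushdownAlphabet B)
    (𝒜 : DyckAutomaton A Q) (m n : ℕ) (φ : List A → B)
    (w : S → Fin (m + n + 1) → Q × A × Q) : Set (S × B × S) :=
  {E | E.2.1 = φ (pathLabel (List.ofFn (w E.1))) ∧
    (∀ k : Fin (m + n), w E.1 k.succ = w E.2.2 k.castSucc) ∧
    w E.1 ⟨m, by omega⟩ ∈ 𝒜.edges ∧
    (w E.1 ⟨m, by omega⟩).2.2 = (w E.2.2 ⟨m, by omega⟩).1 ∧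
    PB.kind E.2.1 = P.kind (w E.1 ⟨m, by omega⟩).2.1}

/-- The sliding-window automaton, whose states encode windows of `m + n + 1` edges of `𝒜`
through `w`. -/
def windowAutomaton {A B Q S : Type*} (P : PushdownAlphabet A) (PB : PushdownAlphabet B)
    (𝒜 : DyckAutomaton A Q) (m n : ℕ) (φ : List A → B)
    (w : S → Fin (m + n + 1) → Q × A × Q) : DyckAutomaton B S where
  edges := windowEdges P PB 𝒜 m n φ w
  matched := {EF | EF.1 ∈ windowEdges P PB 𝒜 m n φ w ∧ EF.2 ∈ windowEdges P PB 𝒜 m n φ w ∧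
    (w EF.1.1 ⟨m, by omega⟩, w EF.2.1 ⟨m, by omega⟩) ∈ 𝒜.matched}

theorem windowAutomaton_wellFormed {A B Q S : Type*} {P : PushdownAlphabet A}
    {PB : PushdownAlphabet B} {𝒜 : DyckAutomaton A Q} (h𝒜 : 𝒜.WellFormed P) (m n : ℕ)
    (φ : List A → B) (w : S → Fin (m + n + 1) → Q × A × Q) :
    (windowAutomaton P PB 𝒜 m n φ w).WellFormed PB := by
  rintro E F ⟨hE, hF, hEF⟩
  obtain ⟨-, -, hcall, hret⟩ := h𝒜 _ _ hEF
  exact ⟨hE, hF, hE.2.2.2.2.trans hcall, hF.2.2.2.2.trans hret⟩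

/-- A sequence of windows, each a shift of the previous one, is read off from its sequence of
entries at a fixed place. -/
theorem window_eq_of_shift {α : Type*} {m n : ℕ} {v : ℤ → Fin (m + n + 1) → α}
    (h : ∀ i, ∀ k : Fin (m + n), v i k.succ = v (i + 1) k.castSucc) (i : ℤ)
    (k : Fin (m + n + 1)) : v i k = v (i - m + k) ⟨m, by omega⟩ := by
  have key : ∀ (k : ℕ) (hk : k < m + n + 1) (i : ℤ), v i ⟨k, hk⟩ = v (i + k) 0 := by
    intro k
    induction k with
    | zero => intro hk i; simp
    | succ k ih =>
      intro hk i
      have h₁ : v i ⟨k + 1, hk⟩ = v (i + 1) ⟨k, by omega⟩ := h i ⟨k, by omega⟩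
      rw [h₁, ih]
      congr 1
      push_cast
      ring
  rw [key m, key k k.2]
  congr 1
  ring

theorem pathLabel_ofFn_eq_factorAt {A Q : Type*} {x : ℤ → A} {i : ℤ} {L : ℕ}
    {v : Fin L → Q × A × Q} (h : ∀ k, (v k).2.1 = x (i + k)) :
    pathLabel (List.ofFn v) = factorAt x i L := by
  refine List.ext_getElem (by simp [pathLabel, factorAt_eq_map]) fun k h₁ h₂ => ?_
  simp [pathLabel, factorAt_eq_map, h]

/-- Provided every window is encoded by some state, the sliding-window automaton presents the
image of the shift presented by `𝒜`. -/
theorem presents_windowAutomaton {A B Q S : Type*} {P : PushdownAlphabet A}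
    {PB : PushdownAlphabet B} {𝒜 : DyckAutomaton A Q} {Φ : (ℤ → A) → ℤ → B} {m n : ℕ}
    {φ : List A → B}
    (hφ : ∀ x ∈ presents P 𝒜, ∀ i : ℤ, Φ x i = φ (factorAt x (i - (m : ℤ)) (m + n + 1)))
    (hp : IsProperOn P PB (presents P 𝒜) Φ) {w : S → Fin (m + n + 1) → Q × A × Q}
    (hw : Function.Surjective w) :
    Φ '' presents P 𝒜 = presents PB (windowAutomaton P PB 𝒜 m n φ w) := by
  ext y
  constructor
  · rintro ⟨x, hx, rfl⟩
    obtain ⟨π, hπ, hlabel⟩ := id hx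
    obtain ⟨hedge, hchain, hmatch⟩ := (biAdmissible_iff _ _ _).1 hπ
    choose s hs using fun i : ℤ => hw fun k => π (i - m + k)
    have hcenter : ∀ i, w (s i) ⟨m, by omega⟩ = π i := fun i => by simp [hs]
    have hkind : ∀ i, PB.kind (Φ x i) = P.kind (π i).2.1 := fun i => by
      rw [hp x hx, hlabel]
    have hE : ∀ i, (s i, Φ x i, s (i + 1)) ∈ windowEdges P PB 𝒜 m n φ w := by
      refine fun i => ⟨?_, ?_, ?_, ?_, ?_⟩
      · rw [hφ x hx, pathLabel_ofFn_eq_factorAt fun k => by rw [hs, hlabel]]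
      · intro k
        simp only [hs, Fin.val_succ, Fin.val_castSucc]
        congr 1
        push_cast
        ring
      · simpa only [hcenter] using hedge i
      · simpa only [hcenter] using hchain i
      · simpa only [hcenter] using hkind i
    refine ⟨fun i => (s i, Φ x i, s (i + 1)), (biAdmissible_iff _ _ _).2
      ⟨hE, fun _ => rfl, fun i l hcall hret hdyck => ⟨hE _, hE _, ?_⟩⟩, fun _ => rfl⟩
    simp only [hcenter]
    refine hmatch i l ((hkind _).symm.trans hcall) ((hkind _).symm.trans hret) ?_
    exact hdyck.of_map_kind_eq (map_kind_pathLabel_pathSeg_congr hkind _ _)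
  · rintro ⟨ρ, hρ, hlabel⟩
    obtain ⟨hedge, hchain, hmatch⟩ := (biAdmissible_iff _ _ _).1 hρ
    have hE : ∀ i, ρ i ∈ windowEdges P PB 𝒜 m n φ w := hedge
    have hkind : ∀ i, P.kind (w (ρ i).1 ⟨m, by omega⟩).2.1 = PB.kind (ρ i).2.1 :=
      fun i => (hE i).2.2.2.2.symm
    have hx : (fun i => (w (ρ i).1 ⟨m, by omega⟩).2.1) ∈ presents P 𝒜 := by
      refine ⟨fun i => w (ρ i).1 ⟨m, by omega⟩, (biAdmissible_iff _ _ _).2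
        ⟨fun i => (hE i).2.2.1, fun i => ?_, fun i l hcall hret hdyck => ?_⟩, fun _ => rfl⟩
      · rw [(hE i).2.2.2.1, hchain]
      · refine (hmatch i l ((hkind _).symm.trans hcall) ((hkind _).symm.trans hret) ?_).2.2
        exact hdyck.of_map_kind_eq (map_kind_pathLabel_pathSeg_congr hkind _ _)
    refine ⟨_, hx, funext fun i => ?_⟩
    have hshift := window_eq_of_shift (v := fun i => w (ρ i).1) fun i k => by
      rw [(hE i).2.1, hchain]
    rw [hφ _ hx, ← hlabel, (hE i).1, pathLabel_ofFn_eq_factorAt fun k => ?_]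
    exact congrArg (fun e => e.2.1) (hshift i k)

end SD

/-- The image of a sofic-Dyck shift under a proper block map is a sofic-Dyck shift. -/
theorem statement_5 {A B : Type*} [Fintype A] [Fintype B]
    (P : PushdownAlphabet A) (PB : PushdownAlphabet B)
    (X : Set (ℤ → A)) (Φ : (ℤ → A) → ℤ → B)
    (hX : IsSoficDyck P X) (hΦ : IsBlockMapOn X Φ) (hp : IsProperOn P PB X Φ) :
    IsSoficDyck PB (Φ '' X) := by
  obtain ⟨N, 𝒜, h𝒜, rfl⟩ := hX
  obtain ⟨m, n, φ, hφ⟩ := hΦ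
  let e := Fintype.equivFin (Fin (m + n + 1) → Fin N × A × Fin N)
  exact ⟨_, windowAutomaton P PB 𝒜 m n φ e.symm, windowAutomaton_wellFormed h𝒜 m n φ _,
    presents_windowAutomaton hφ hp e.symm.surjective⟩
end
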